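/- Let V be a linear subspace of GF(2)^E and let e ∈ E. Then d(V/e) = d(V) − 1 if and only if there exists y ∈ V ∩ V⊥ with y(e) ≠ 0. (That is, the part F_{−1} of the canonical tripartition equals the union of the supports of the vectors of the bicycle space V ∩ V⊥.) -/

import Mathlib

open Finset

attribute [local instance] Classical.propDecidable

variable {E : Type*}

/-- The support of a vector in `GF(2)^E`, as a `Finset`. -/
def supp [Fintype E] (x : E → ZMod 2) : Finset E :=
  Finset.univ.filter fun e => x e ≠ 0

/-- The standard bilinear form `⟨x,y⟩ = ∑ e, x e * y e` on `GF(2)^E`. -/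
def bilin [Fintype E] (x y : E → ZMod 2) : ZMod 2 := ∑ e, x e * y e

/-- The orthogonal complement of a subspace of `GF(2)^E` w.r.t. `bilin`. -/
def perp [Fintype E] (V : Submodule (ZMod 2) (E → ZMod 2)) :
    Submodule (ZMod 2) (E → ZMod 2) where
  carrier := {w | ∀ v ∈ V, bilin w v = 0}
  zero_mem' := by intro v hv; simp [bilin]
  add_mem' := by
    intro a b ha hb v hv
    have ha' := ha v hv
    have hb' := hb v hv
    simp only [bilin, Pi.add_apply, add_mul] at *
    rw [Finset.sum_add_distrib, ha', hb', add_zero]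
  smul_mem' := by
    intro c a ha v hv
    have ha' := ha v hv
    simp only [bilin, Pi.smul_apply, smul_eq_mul, mul_assoc] at *
    rw [← Finset.mul_sum, ha', mul_zero]

/-- The bicycle dimension `d(V) = dim (V ∩ V⊥)`. -/
noncomputable def bdim [Fintype E] (V : Submodule (ZMod 2) (E → ZMod 2)) : ℕ :=
  Module.finrank (ZMod 2) ↥(V ⊓ perp V)

/-- The contraction `V/e ⊆ GF(2)^{E∖{e}}`: the image of `V` under the restriction map
`v ↦ v|_{E∖{e}}`. -/
def contr [Fintype E] (V : Submodule (ZMod 2) (E → ZMod 2)) (e : E) :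
    Submodule (ZMod 2) ({e' : E // e' ≠ e} → ZMod 2) :=
  V.map (LinearMap.funLeft (ZMod 2) (ZMod 2) (fun e' : {e' : E // e' ≠ e} => (e' : E)))

theorem bilin_restrict [Fintype E] (e : E) (v w : E → ZMod 2) :
    bilin v w = v e * w e +
      bilin (LinearMap.funLeft (ZMod 2) (ZMod 2) (fun e' : {e' : E // e' ≠ e} => (e' : E)) v)
        (LinearMap.funLeft (ZMod 2) (ZMod 2) (fun e' : {e' : E // e' ≠ e} => (e' : E)) w) := by
  simp only [bilin, LinearMap.funLeft_apply]
  exact Fintype.sum_eq_add_sum_subtype_ne (fun i => v i * w i) e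

/-- The bicycles vanishing at `e`. -/
def bic0 [Fintype E] (V : Submodule (ZMod 2) (E → ZMod 2)) (e : E) :
    Submodule (ZMod 2) (E → ZMod 2) :=
  (LinearMap.ker ((LinearMap.proj (R := ZMod 2) (φ := fun _ : E => ZMod 2) e).domRestrict
    (V ⊓ perp V))).map (V ⊓ perp V).subtype

theorem mem_bic0 [Fintype E] (V : Submodule (ZMod 2) (E → ZMod 2)) (e : E) (x : E → ZMod 2) :
    x ∈ bic0 V e ↔ x ∈ V ⊓ perp V ∧ x e = 0 := by
  unfold bic0
  constructor
  · rintro ⟨⟨y, hy⟩, h, rfl⟩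
    exact ⟨hy, h⟩
  · rintro ⟨h, h0⟩
    exact ⟨⟨x, h⟩, h0, rfl⟩

theorem finrank_bic0_map [Fintype E] (V : Submodule (ZMod 2) (E → ZMod 2)) (e : E) :
    Module.finrank (ZMod 2) ((bic0 V e).map (LinearMap.funLeft (ZMod 2) (ZMod 2)
      (fun e' : {e' : E // e' ≠ e} => (e' : E)))) = Module.finrank (ZMod 2) (bic0 V e) := by
  rw [← LinearMap.range_domRestrict]
  apply LinearMap.finrank_range_of_inj
  rw [← LinearMap.ker_eq_bot, LinearMap.ker_eq_bot']
  rintro ⟨x, hx⟩ h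
  ext i
  have h0 := ((mem_bic0 V e x).1 hx).2
  by_cases hi : i = e
  · subst hi; exact h0
  · exact congrFun h ⟨i, hi⟩

theorem bic0_map_le [Fintype E] (V : Submodule (ZMod 2) (E → ZMod 2)) (e : E) :
    (bic0 V e).map (LinearMap.funLeft (ZMod 2) (ZMod 2)
      (fun e' : {e' : E // e' ≠ e} => (e' : E))) ≤ contr V e ⊓ perp (contr V e) := by
  rintro _ ⟨x, hx, rfl⟩
  obtain ⟨⟨hV, hp⟩, h0⟩ := (mem_bic0 V e x).1 hx
  refine ⟨⟨x, hV, rfl⟩, ?_⟩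
  rintro _ ⟨w, hw, rfl⟩
  have := bilin_restrict e x w
  rw [hp w hw, h0, zero_mul, zero_add] at this
  exact this.symm

theorem le_bic0_map [Fintype E] (V : Submodule (ZMod 2) (E → ZMod 2)) (e : E)
    (y : E → ZMod 2) (hy : y ∈ V ⊓ perp V) (hye : y e ≠ 0) :
    contr V e ⊓ perp (contr V e) ≤ (bic0 V e).map (LinearMap.funLeft (ZMod 2) (ZMod 2)
      (fun e' : {e' : E // e' ≠ e} => (e' : E))) := by
  rintro _ ⟨⟨x, hx, rfl⟩, hp⟩
  have key : ∀ w ∈ V, bilin x w = x e * w e := by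
    intro w hw
    rw [bilin_restrict e x w, hp _ ⟨w, hw, rfl⟩, add_zero]
  have h0 : x e = 0 := by
    have h1 := key y hy.1
    have h2 : bilin x y = 0 := by
      rw [← hy.2 x hx]; simp only [bilin, mul_comm]
    rw [h2] at h1
    exact (mul_eq_zero.1 h1.symm).resolve_right hye
  refine ⟨x, (mem_bic0 V e x).2 ⟨⟨hx, ?_⟩, h0⟩, rfl⟩
  intro w hw
  rw [key w hw, h0, zero_mul]

theorem finrank_bic0 [Fintype E] (V : Submodule (ZMod 2) (E → ZMod 2)) (e : E)
    (y : E → ZMod 2) (hy : y ∈ V ⊓ perp V) (hye : y e ≠ 0) :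
    Module.finrank (ZMod 2) (bic0 V e) + 1 = bdim V := by
  have h := LinearMap.finrank_range_add_finrank_ker
    ((LinearMap.proj (R := ZMod 2) (φ := fun _ : E => ZMod 2) e).domRestrict (V ⊓ perp V))
  have hr : LinearMap.range ((LinearMap.proj (R := ZMod 2)
      (φ := fun _ : E => ZMod 2) e).domRestrict (V ⊓ perp V)) = ⊤ := by
    rw [LinearMap.range_eq_top]
    apply LinearMap.surjective
    intro h
    exact hye (LinearMap.congr_fun h ⟨y, hy⟩)
  rw [hr, finrank_top, Module.finrank_self] at h
  unfold bic0 bdim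
  rw [Submodule.finrank_map_subtype_eq]
  omega

/-- `d(V/e) = d(V) - 1` if and only if some bicycle `y ∈ V ∩ V⊥` has `y e ≠ 0`. -/
theorem statement10 [Fintype E] (V : Submodule (ZMod 2) (E → ZMod 2)) (e : E) :
    (bdim (contr V e) : ℤ) = (bdim V : ℤ) - 1 ↔ ∃ y ∈ V ⊓ perp V, y e ≠ 0 := by
  constructor
  · intro h
    by_contra! hn
    have hB : bic0 V e = V ⊓ perp V := by
      ext x
      rw [mem_bic0]
      exact ⟨fun h => h.1, fun h => ⟨h, hn x h⟩⟩
    have h1 := finrank_bic0_map V e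
    have h2 := Submodule.finrank_mono (bic0_map_le V e)
    rw [h1, hB] at h2
    unfold bdim at h
    omega
  · rintro ⟨y, hy, hye⟩
    have h1 := finrank_bic0 V e y hy hye
    have h2 := finrank_bic0_map V e
    rw [le_antisymm (bic0_map_le V e) (le_bic0_map V e y hy hye)] at h2
    have h3 : bdim (contr V e) = Module.finrank (ZMod 2) (bic0 V e) := by
      rw [← h2]; unfold bdim; congr!
    omega
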